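/- The function y ↦ (e/π) sin(πy) y^{−y} (1−y)^{−(1−y)} on (0,1) is a probability density, i.e., ∫₀¹ (e/π) sin(πy) y^{−y}(1−y)^{−(1−y)} dy = 1. -/

import Mathlib

open Real MeasureTheory Set

/-- The integrand of the contour integral, after the change of variables. -/
noncomputable def KK (u : ℂ) : ℂ :=
  (Complex.exp (1 - u / (1 - Complex.exp (-u))) - 1) / (1 - Complex.exp (-u))

/-- Denominator divided by `u`, with the removable singularity filled in. -/
noncomputable def DD : ℂ → ℂ := dslope (fun u : ℂ => 1 - Complex.exp (-u)) 0

noncomputable def GG (u : ℂ) : ℂ := Complex.exp (1 - 1 / DD u) - 1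

noncomputable def SS : Set ℂ := {u | -(2 * π) < u.im ∧ u.im < 2 * π}

lemma SS_nhds : SS ∈ nhds (0 : ℂ) := by
  apply IsOpen.mem_nhds
  · exact (isOpen_lt continuous_const Complex.continuous_im).inter
      (isOpen_lt Complex.continuous_im continuous_const)
  · constructor <;> simp [Real.pi_pos]

lemma DD_diff : Differentiable ℂ DD := by
  rw [← differentiableOn_univ]
  apply (Complex.differentiableOn_dslope Filter.univ_mem).2
  fun_prop

lemma DD_zero : DD 0 = 1 := by
  rw [DD, dslope_same]
  have h : HasDerivAt (fun u : ℂ => 1 - Complex.exp (-u)) (-(Complex.exp (-0) * (-1))) 0 :=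
    ((hasDerivAt_id (0 : ℂ)).neg.cexp).const_sub 1
  rw [h.deriv]; simp

lemma DD_ne (u : ℂ) (hu : u ≠ 0) : DD u = (1 - Complex.exp (-u)) / u := by
  rw [DD, dslope_of_ne _ hu, slope_def_field]; simp

lemma den_ne (u : ℂ) (hu : u ≠ 0) (hs : u ∈ SS) : 1 - Complex.exp (-u) ≠ 0 := by
  intro h
  have h1 : Complex.exp (-u) = 1 := (sub_eq_zero.1 h).symm
  obtain ⟨n, hn⟩ := Complex.exp_eq_one_iff.1 h1
  have him : -u.im = n * (2 * π) := by
    have := congrArg Complex.im hn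
    simpa using this
  have hp := Real.pi_pos
  obtain ⟨a, b⟩ := hs
  have h2 : (n : ℝ) < 1 := by by_contra hc; push Not at hc; nlinarith
  have h3 : (-1 : ℝ) < n := by by_contra hc; push Not at hc; nlinarith
  have h4 : n < 1 := by exact_mod_cast h2
  have h5 : -1 < n := by exact_mod_cast h3
  have : n = 0 := by omega
  subst this
  apply hu
  simpa using hn

lemma DD_ne_zero (u : ℂ) (hs : u ∈ SS) : DD u ≠ 0 := by
  by_cases hu : u = 0
  · subst hu; simp [DD_zero]
  · rw [DD_ne u hu]; exact div_ne_zero (den_ne u hu hs) hu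

lemma GG_diff : DifferentiableOn ℂ GG SS := by
  intro u hu
  apply DifferentiableAt.differentiableWithinAt
  unfold GG
  have := DD_diff u
  have h2 := DD_ne_zero u hu
  exact (((differentiableAt_const _).sub ((differentiableAt_const _).div this h2)).cexp).sub_const _

noncomputable def LL (u : ℂ) : ℂ := dslope GG 0 u / DD u

lemma LL_diff : DifferentiableOn ℂ LL SS :=
  ((Complex.differentiableOn_dslope SS_nhds).2 GG_diff).div DD_diff.differentiableOn DD_ne_zero

lemma LL_eq (u : ℂ) (hu : u ≠ 0) : LL u = KK u := by
  have : GG 0 = 0 := by simp [GG, DD_zero]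
  rw [LL, KK, dslope_of_ne _ hu, slope_def_field, this, GG, DD_ne u hu]
  simp only [sub_zero, one_div_div]
  rw [div_div_div_cancel_right₀ hu]

lemma KK_neg (u : ℂ) (hu : u ≠ 0) (hs : u ∈ SS) : KK u = -1 - KK (-u) := by
  have h := den_ne u hu hs
  have he : Complex.exp u ≠ 0 := Complex.exp_ne_zero u
  have h1 : Complex.exp (-u) = (Complex.exp u)⁻¹ := Complex.exp_neg u
  rw [h1] at h
  have h2 : Complex.exp u - 1 ≠ 0 := by
    intro h3; apply h; rw [sub_eq_zero.1 h3]; simp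
  have h2' : 1 - Complex.exp u ≠ 0 := by
    intro h3; apply h2; linear_combination -h3
  have h4 : (1 : ℂ) - u / (1 - Complex.exp (-u)) = (1 - -u / (1 - Complex.exp u)) + -u := by
    rw [h1]
    have : 1 - (Complex.exp u)⁻¹ = (Complex.exp u - 1) / Complex.exp u := by field_simp
    rw [this]; field_simp; ring
  rw [KK, KK, neg_neg, h4, Complex.exp_add, h1]
  have : 1 - (Complex.exp u)⁻¹ = (Complex.exp u - 1) / Complex.exp u := by field_simp
  rw [this]
  generalize Complex.exp (1 - -u / (1 - Complex.exp u)) = E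
  field_simp; ring

lemma KK_bound (R y : ℝ) (hR : 1 ≤ R) (hy : |y| ≤ π) :
    ‖KK ((-R : ℝ) + y * Complex.I)‖ ≤ (Real.exp (2 + π) + 1) / R := by
  set u : ℂ := (-R : ℝ) + y * Complex.I with hu
  have hp := Real.pi_pos
  have hre : (-u).re = R := by simp [hu]
  have hd : R ≤ ‖1 - Complex.exp (-u)‖ := by
    have h1 := norm_sub_norm_le (Complex.exp (-u)) 1
    rw [Complex.norm_exp, hre, norm_sub_rev] at h1
    have := Real.add_one_le_exp R
    simp only [norm_one] at h1
    linarith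
  have hun : ‖u‖ ≤ R + π := by
    refine (norm_add_le _ _).trans ?_
    simp [abs_of_pos (by linarith : 0 < R)]
    exact hy
  have hq : ‖u / (1 - Complex.exp (-u))‖ ≤ 1 + π := by
    rw [norm_div, div_le_iff₀ (by linarith)]
    nlinarith
  have hE : ‖Complex.exp (1 - u / (1 - Complex.exp (-u)))‖ ≤ Real.exp (2 + π) := by
    rw [Complex.norm_exp]
    apply Real.exp_le_exp.2
    have := (abs_le.1 ((Complex.abs_re_le_norm _).trans hq)).1
    rw [Complex.sub_re, Complex.one_re]
    linarith
  rw [KK, norm_div]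
  apply div_le_div₀ (by positivity) _ (by linarith) hd
  refine (norm_sub_le _ _).trans ?_
  simpa using hE

noncomputable def sg (t : ℝ) : ℝ := 1 / (1 + Real.exp (-t))

noncomputable def hh (t : ℝ) : ℝ := Real.exp (1 - t * sg t) * sg t * Real.sin (π * sg t)

lemma KK_diff (t : ℝ) : KK (t + (-π : ℝ) * Complex.I) - KK (t + (π : ℝ) * Complex.I)
    = 2 * Complex.I * (hh t : ℂ) := by
  have e1 : Complex.exp (-(t + (-π : ℝ) * Complex.I)) = -(Real.exp (-t) : ℂ) := by
    rw [show -((t : ℂ) + (-π : ℝ) * Complex.I) = -t + π * Complex.I by push_cast; ring,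
      Complex.exp_add, Complex.exp_pi_mul_I]
    push_cast; ring
  have e2 : Complex.exp (-(t + (π : ℝ) * Complex.I)) = -(Real.exp (-t) : ℂ) := by
    rw [show -((t : ℂ) + (π : ℝ) * Complex.I) = -t + -(π * Complex.I) by push_cast; ring,
      Complex.exp_add, Complex.exp_neg (π * Complex.I), Complex.exp_pi_mul_I]
    push_cast; norm_num
  have hs : (1 - -(Real.exp (-t) : ℂ)) = ((sg t : ℝ) : ℂ)⁻¹ := by
    rw [sg]; push_cast; simp
  rw [KK, KK, e1, e2, hs, hh]
  simp only [div_inv_eq_mul]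
  push_cast
  rw [show (1 : ℂ) - (t + -π * Complex.I) * sg t = (1 - t * sg t) + (π * sg t) * Complex.I by ring,
    show (1 : ℂ) - (t + π * Complex.I) * sg t = (1 - t * sg t) + (-(π * sg t)) * Complex.I by ring,
    Complex.exp_add, Complex.exp_add, Complex.exp_mul_I, Complex.exp_mul_I, Complex.cos_neg,
    Complex.sin_neg]
  ring

lemma u_ne (x y : ℝ) (h : x ≠ 0 ∨ y ≠ 0) : (x : ℂ) + y * Complex.I ≠ 0 := by
  intro h0
  have h1 := congrArg Complex.re h0
  have h2 := congrArg Complex.im h0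
  simp at h1 h2
  tauto

lemma u_mem (x y : ℝ) (h : |y| ≤ π) : (x : ℂ) + y * Complex.I ∈ SS := by
  have hp := Real.pi_pos
  obtain ⟨a, b⟩ := abs_le.1 h
  constructor <;> simp <;> linarith

lemma sg_cont : Continuous sg := by
  unfold sg
  refine continuous_const.div (by fun_prop) (fun x => by positivity)

lemma LL_cont_line {f : ℝ → ℂ} (hf : Continuous f) {s : Set ℝ} (h : ∀ x ∈ s, f x ∈ SS) :
    ContinuousOn (fun x => LL (f x)) s :=
  LL_diff.continuousOn.comp hf.continuousOn h

lemma main_R (R : ℝ) (hR : 1 ≤ R) :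
    |(∫ t in (-R)..R, hh t) - π| ≤ (Real.exp (2 + π) + 1) / R * (2 * π) := by
  have hp := Real.pi_pos
  have hc := Complex.integral_boundary_rect_eq_zero_of_differentiableOn LL
    (⟨-R, -π⟩ : ℂ) (⟨R, π⟩ : ℂ) (LL_diff.mono (by
      intro u hu
      rw [Complex.mem_reProdIm] at hu
      obtain ⟨_, h2⟩ := hu
      simp only at h2
      rw [uIcc_of_le (by linarith)] at h2
      constructor <;> linarith [h2.1, h2.2]))
  simp only at hc
  have i1 : (∫ x in (-R)..R, LL (x + (-π : ℝ) * Complex.I)) -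
      (∫ x in (-R)..R, LL (x + (π : ℝ) * Complex.I)) =
      2 * Complex.I * ((∫ t in (-R)..R, hh t : ℝ) : ℂ) := by
    rw [← intervalIntegral.integral_sub, ← intervalIntegral.integral_ofReal,
      ← intervalIntegral.integral_const_mul]
    · apply intervalIntegral.integral_congr
      intro t _
      simp only
      rw [LL_eq _ (u_ne _ _ (Or.inr (by linarith))), LL_eq _ (u_ne _ _ (Or.inr (by linarith)))]
      exact KK_diff t
    · exact (LL_cont_line (by fun_prop)
        (fun x _ => u_mem x _ (by rw [abs_neg, abs_of_pos hp]))).intervalIntegrable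
    · exact (LL_cont_line (by fun_prop)
        (fun x _ => u_mem x _ (by rw [abs_of_pos hp]))).intervalIntegrable
  have huI : ∀ y ∈ uIcc (-π) π, |y| ≤ π := by
    intro y hy
    rw [uIcc_of_le (by linarith)] at hy
    exact abs_le.2 hy
  have i2 : (∫ y in (-π)..π, LL ((R : ℝ) + y * Complex.I)) =
      -(2 * π) - ∫ y in (-π)..π, LL ((-R : ℝ) + y * Complex.I) := by
    have hsymm : (∫ y in (-π)..π, LL ((-R : ℝ) + y * Complex.I)) =
        ∫ y in (-π)..π, LL ((-R : ℝ) + (-y : ℝ) * Complex.I) := by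
      rw [intervalIntegral.integral_comp_neg (fun y : ℝ => LL ((-R : ℝ) + y * Complex.I)), neg_neg]
    have hconst : (-(2 * π) : ℂ) = ∫ y in (-π)..π, (-1 : ℂ) := by
      rw [intervalIntegral.integral_const]; simp; ring
    rw [hsymm, hconst, ← intervalIntegral.integral_sub]
    · apply intervalIntegral.integral_congr
      intro y hy
      simp only
      rw [LL_eq _ (u_ne _ _ (Or.inl (by linarith))), LL_eq _ (u_ne _ _ (Or.inl (by linarith))),
        KK_neg _ (u_ne _ _ (Or.inl (by linarith))) (u_mem _ _ (huI y hy))]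
      congr 2
      push_cast; ring
    · exact intervalIntegrable_const
    · exact (LL_cont_line (by fun_prop)
        (fun y hy => u_mem _ _ (by rw [abs_neg]; exact huI y hy))).intervalIntegrable
  have i3 : ‖∫ y in (-π)..π, LL ((-R : ℝ) + y * Complex.I)‖ ≤
      (Real.exp (2 + π) + 1) / R * |π - -π| := by
    apply intervalIntegral.norm_integral_le_of_norm_le_const
    intro y hy
    rw [LL_eq _ (u_ne _ _ (Or.inl (by linarith)))]
    exact KK_bound R y hR (huI y (uIoc_subset_uIcc hy))
  rw [i1, i2] at hc
  simp only [smul_eq_mul] at hc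
  set J := ∫ y in (-π)..π, LL ((-R : ℝ) + y * Complex.I) with hJ
  have hfin : (((∫ t in (-R)..R, hh t) - π : ℝ) : ℂ) = J := by
    have h2I : (2 * Complex.I : ℂ) ≠ 0 := by simp
    apply mul_left_cancel₀ h2I
    push_cast
    linear_combination hc
  rw [← hfin, Complex.norm_real, Real.norm_eq_abs] at i3
  rw [show |π - -π| = 2 * π by rw [abs_of_pos] <;> linarith] at i3
  exact i3

noncomputable def FF (y : ℝ) : ℝ :=
  Real.exp 1 * Real.sin (π * y) * Real.exp (Real.negMulLog y + Real.negMulLog (1 - y))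

lemma FF_cont : Continuous FF := by
  unfold FF
  have h1 := Real.continuous_negMulLog
  fun_prop

lemma sg_deriv (t : ℝ) : HasDerivAt sg (sg t * (1 - sg t)) t := by
  have hpos : 1 + Real.exp (-t) ≠ 0 := by positivity
  have h : HasDerivAt (fun t : ℝ => 1 + Real.exp (-t)) (Real.exp (-t) * -1) t :=
    ((hasDerivAt_id t).neg.exp).const_add 1
  have h2 := h.inv hpos
  have h3 : sg = (fun t : ℝ => 1 + Real.exp (-t))⁻¹ := by
    ext x; simp [sg]
  rw [← h3] at h2
  have h4 : sg t * (1 - sg t) = -(Real.exp (-t) * -1) / (1 + Real.exp (-t)) ^ 2 := by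
    simp only [sg]
    field_simp
    ring
  rw [h4]
  exact h2

lemma FF_sg (t : ℝ) : FF (sg t) * (sg t * (1 - sg t)) = hh t := by
  have he := Real.exp_pos (-t)
  have hs : 0 < sg t := by unfold sg; positivity
  have h1 : 1 - sg t = Real.exp (-t) * sg t := by
    unfold sg; field_simp; ring
  have h1p : 0 < 1 - sg t := by rw [h1]; positivity
  have hl : Real.log (1 - sg t) = -t + Real.log (sg t) := by
    rw [h1, Real.log_mul he.ne' hs.ne', Real.log_exp]
  have hx : Real.negMulLog (sg t) + Real.negMulLog (1 - sg t)
      = -(t * sg t) - Real.log (1 - sg t) := by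
    simp only [Real.negMulLog]; rw [hl]; ring
  rw [FF, hh, hx, Real.exp_sub, Real.exp_log h1p, sub_eq_add_neg 1 (t * sg t), Real.exp_add]
  field_simp

lemma int_sub (R : ℝ) : ∫ t in (-R)..R, hh t = ∫ y in (sg (-R))..(sg R), FF y := by
  rw [← intervalIntegral.integral_comp_mul_deriv (fun x _ => sg_deriv x) _ FF_cont]
  · apply intervalIntegral.integral_congr
    intro t _
    exact (FF_sg t).symm
  · have := sg_cont
    fun_prop

lemma FF_int : ∫ y in (0:ℝ)..1, FF y = π := by
  have a1 : Filter.Tendsto (fun R : ℝ => sg R) Filter.atTop (nhds 1) := by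
    have h : Filter.Tendsto (fun R : ℝ => 1 / (1 + Real.exp (-R))) Filter.atTop
        (nhds (1 / (1 + 0))) :=
      tendsto_const_nhds.div (tendsto_const_nhds.add
        (Real.tendsto_exp_neg_atTop_nhds_zero)) (by norm_num)
    simpa [sg] using h
  have a0 : Filter.Tendsto (fun R : ℝ => sg (-R)) Filter.atTop (nhds 0) := by
    have h : ∀ R, sg (-R) = 1 - sg R := by
      intro R
      unfold sg
      rw [neg_neg, Real.exp_neg]
      have := Real.exp_pos R
      field_simp
      ring
    simp only [h]
    simpa using a1.const_sub 1
  have hprim : Continuous (fun b : ℝ => ∫ y in (0:ℝ)..b, FF y) :=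
    intervalIntegral.continuous_primitive (fun a b => FF_cont.intervalIntegrable a b) 0
  have l1 : Filter.Tendsto (fun R : ℝ => ∫ t in (-R)..R, hh t) Filter.atTop
      (nhds (∫ y in (0:ℝ)..1, FF y)) := by
    have h := ((hprim.tendsto 1).comp a1).sub ((hprim.tendsto 0).comp a0)
    simp only [intervalIntegral.integral_same, sub_zero] at h
    refine h.congr (fun R => ?_)
    rw [int_sub]
    exact intervalIntegral.integral_interval_sub_left (FF_cont.intervalIntegrable _ _)
      (FF_cont.intervalIntegrable _ _)
  have l2 : Filter.Tendsto (fun R : ℝ => ∫ t in (-R)..R, hh t) Filter.atTop (nhds π) := by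
    rw [tendsto_iff_norm_sub_tendsto_zero]
    have hz : Filter.Tendsto (fun R : ℝ => (Real.exp (2 + π) + 1) / R * (2 * π)) Filter.atTop
        (nhds 0) := by
      have := (Filter.tendsto_id (α := ℝ) (x := Filter.atTop)).const_div_atTop
        (Real.exp (2 + π) + 1)
      simpa using this.mul_const (2 * π)
    refine squeeze_zero' (Filter.Eventually.of_forall fun R => norm_nonneg _) ?_ hz
    filter_upwards [Filter.eventually_ge_atTop 1] with R hR
    exact main_R R hR
  exact tendsto_nhds_unique l1 l2

theorem stmt_14 :
    ∫ y in Ioo (0:ℝ) 1,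
      (Real.exp 1 / π) * Real.sin (π * y) * y ^ (-y) * (1 - y) ^ (-(1 - y)) = 1 := by
  have h : ∫ y in Ioo (0:ℝ) 1,
      (Real.exp 1 / π) * Real.sin (π * y) * y ^ (-y) * (1 - y) ^ (-(1 - y))
      = ∫ y in Ioo (0:ℝ) 1, π⁻¹ * FF y := by
    apply setIntegral_congr_fun measurableSet_Ioo
    intro y hy
    have h1 : 0 < 1 - y := by linarith [hy.2]
    simp only
    rw [Real.rpow_def_of_pos hy.1, Real.rpow_def_of_pos h1, FF, Real.exp_add, Real.negMulLog,
      Real.negMulLog, show Real.log y * -y = -y * Real.log y by ring,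
      show Real.log (1 - y) * -(1 - y) = -(1 - y) * Real.log (1 - y) by ring]
    ring
  rw [h, ← integral_Ioc_eq_integral_Ioo, ← intervalIntegral.integral_of_le zero_le_one,
    intervalIntegral.integral_const_mul, FF_int]
  exact inv_mul_cancel₀ Real.pi_ne_zero
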